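/- Adopt the following setup: n_r, n_c, d_r, d_c positive integers, N_r = n_r·d_r, N_c = n_c·d_c, d = d_r·d_c; F the unitary 2D DFT on ℂ-valued images indexed by ZMod N_r × ZMod N_c; S the decimation operator with zero-filling adjoint S^H; λ̂, γ̂_1, …, γ̂_s : ZMod N_r × ZMod N_c → ℂ; K = F^H Λ F, L_j = F^H Γ_j F with Λ, Γ_j pointwise multiplication by λ̂, γ̂_j; ζ = Σ_j |γ̂_j|²; ε > 0, μ > 0; b an image on the low-resolution grid, v_1,…,v_s images on the high-resolution grid; x*(μ) the unique minimizer of x ↦ (μ/2)‖SKx − b‖₂² + (1/2)Σ_j‖L_j x − v_j‖₂² + (ε/2)‖x‖₂²; and r_H(μ) = K x*(μ) − S^H b the high-resolution residual. For each residue class c ∈ ZMod n_r × ZMod n_c define η_c = (1/d)·Σ_{(p,q)∈c} |λ̂(p,q)|²/(ζ(p,q)+ε), ρ_c = Σ_{(p,q)∈c} (F S^H b)(p,q), and ν_c = Σ_{(p,q)∈c} λ̂(p,q)·(Σ_j conj(γ̂_j(p,q))·(F v_j)(p,q))/(ζ(p,q)+ε). Then for every residue class c, Σ_{(p,q)∈c}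 (F r_H(μ))(p,q) = (ν_c − ρ_c)/(1 + η_c·μ). -/

import Mathlib

open scoped BigOperators

/-- Unitary 2D discrete Fourier transform on images indexed by `ZMod a × ZMod b`. -/
noncomputable def dft2 (a b : ℕ) [NeZero a] [NeZero b]
    (x : ZMod a × ZMod b → ℂ) : ZMod a × ZMod b → ℂ := fun pq =>
  (1 / (Real.sqrt ((a : ℝ) * b) : ℂ)) *
    ∑ ij : ZMod a × ZMod b,
      Complex.exp (-(2 * (Real.pi : ℂ)) * Complex.I *
        (((pq.1.val * ij.1.val : ℕ) : ℂ) / (a : ℂ) +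
         ((pq.2.val * ij.2.val : ℕ) : ℂ) / (b : ℂ))) * x ij

/-- Inverse (conjugate transpose) of the unitary 2D DFT. -/
noncomputable def idft2 (a b : ℕ) [NeZero a] [NeZero b]
    (x : ZMod a × ZMod b → ℂ) : ZMod a × ZMod b → ℂ := fun pq =>
  (1 / (Real.sqrt ((a : ℝ) * b) : ℂ)) *
    ∑ ij : ZMod a × ZMod b,
      Complex.exp ((2 * (Real.pi : ℂ)) * Complex.I *
        (((pq.1.val * ij.1.val : ℕ) : ℂ) / (a : ℂ) +
         ((pq.2.val * ij.2.val : ℕ) : ℂ) / (b : ℂ))) * x ij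

/-- Decimation operator `S`: `(S x)(i,j) = x (d_r·i, d_c·j)`. -/
def decim (n_r n_c d_r d_c : ℕ) {α : Type*}
    (x : ZMod (n_r * d_r) × ZMod (n_c * d_c) → α) :
    ZMod n_r × ZMod n_c → α := fun ij =>
  x (((d_r * ij.1.val : ℕ) : ZMod (n_r * d_r)), ((d_c * ij.2.val : ℕ) : ZMod (n_c * d_c)))

/-- Zero-filling adjoint `S^H` of the decimation operator. -/
def zfill (n_r n_c d_r d_c : ℕ) {α : Type*} [Zero α]
    (y : ZMod n_r × ZMod n_c → α) :
    ZMod (n_r * d_r) × ZMod (n_c * d_c) → α := fun pq =>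
  if d_r ∣ pq.1.val ∧ d_c ∣ pq.2.val then
    y (((pq.1.val / d_r : ℕ) : ZMod n_r), ((pq.2.val / d_c : ℕ) : ZMod n_c))
  else 0

/-- Circular sample autocorrelation of a real image. -/
def acorr (a b : ℕ) [NeZero a] [NeZero b] (e : ZMod a × ZMod b → ℝ) :
    ZMod a × ZMod b → ℝ := fun lm =>
  ∑ ij : ZMod a × ZMod b, e ij * e (ij.1 + lm.1, ij.2 + lm.2)

lemma ZMod.stdAddChar_eq_exp_val_mul {N : ℕ} [NeZero N] (p i : ZMod N) :
    ZMod.stdAddChar (p * i) =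
      Complex.exp (2 * Real.pi * Complex.I * (((p.val * i.val : ℕ) : ℂ) / N)) := by
  have h := ZMod.stdAddChar_coe (N := N) ((p.val * i.val : ℕ) : ℤ)
  have h2 : ((((p.val * i.val : ℕ) : ℤ)) : ZMod N) = p * i := by
    push_cast; simp
  rw [h2] at h
  rw [h]
  congr 1
  push_cast
  ring

lemma ZMod.stdAddChar_neg_eq_exp_val_mul {N : ℕ} [NeZero N] (p i : ZMod N) :
    ZMod.stdAddChar (-(p * i)) =
      Complex.exp (-(2 * Real.pi) * Complex.I * (((p.val * i.val : ℕ) : ℂ) / N)) := by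
  rw [AddChar.map_neg_eq_inv, ZMod.stdAddChar_eq_exp_val_mul, ← Complex.exp_neg]
  congr 1
  ring

lemma ZMod.conj_stdAddChar {N : ℕ} [NeZero N] (p : ZMod N) :
    (starRingEnd ℂ) (ZMod.stdAddChar p) = ZMod.stdAddChar (-p) :=
  (AddChar.map_neg_eq_conj _ _).symm

section DFT

variable {a b : ℕ} [NeZero a] [NeZero b]

lemma dft2_apply (x : ZMod a × ZMod b → ℂ) (pq : ZMod a × ZMod b) :
    dft2 a b x pq = (1 / (Real.sqrt ((a : ℝ) * b) : ℂ)) *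
      ∑ ij : ZMod a × ZMod b,
        ZMod.stdAddChar (-(pq.1 * ij.1)) * ZMod.stdAddChar (-(pq.2 * ij.2)) * x ij := by
  simp only [dft2, ZMod.stdAddChar_neg_eq_exp_val_mul, ← Complex.exp_add, mul_add]

lemma idft2_apply (x : ZMod a × ZMod b → ℂ) (pq : ZMod a × ZMod b) :
    idft2 a b x pq = (1 / (Real.sqrt ((a : ℝ) * b) : ℂ)) *
      ∑ ij : ZMod a × ZMod b,
        ZMod.stdAddChar (pq.1 * ij.1) * ZMod.stdAddChar (pq.2 * ij.2) * x ij := by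
  simp only [idft2, ZMod.stdAddChar_eq_exp_val_mul, ← Complex.exp_add, mul_add]

lemma dft2_sub (x y : ZMod a × ZMod b → ℂ) (pq : ZMod a × ZMod b) :
    dft2 a b (fun i => x i - y i) pq = dft2 a b x pq - dft2 a b y pq := by
  simp only [dft2_apply, mul_sub, Finset.sum_sub_distrib]

lemma dft2_add_mul (t : ℂ) (x y : ZMod a × ZMod b → ℂ) (pq : ZMod a × ZMod b) :
    dft2 a b (fun i => x i + t * y i) pq = dft2 a b x pq + t * dft2 a b y pq := by
  simp only [dft2_apply, mul_add, Finset.sum_add_distrib, Finset.mul_sum]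
  congr 1
  exact Finset.sum_congr rfl fun _ _ => by ring

lemma idft2_add_mul (t : ℂ) (x y : ZMod a × ZMod b → ℂ) (pq : ZMod a × ZMod b) :
    idft2 a b (fun i => x i + t * y i) pq = idft2 a b x pq + t * idft2 a b y pq := by
  simp only [idft2_apply, mul_add, Finset.sum_add_distrib, Finset.mul_sum]
  congr 1
  exact Finset.sum_congr rfl fun _ _ => by ring

lemma ZMod.sum_stdAddChar_neg_mul_mul {N : ℕ} [NeZero N] (p q : ZMod N) :
    ∑ i : ZMod N, (ZMod.stdAddChar (-(p * i)) * ZMod.stdAddChar (i * q) : ℂ) =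
      if p = q then (N : ℂ) else 0 := by
  have h := AddChar.sum_mulShift (R := ZMod N) (R' := ℂ) (q - p)
    (ZMod.isPrimitive_stdAddChar N)
  rw [ZMod.card] at h
  calc _ = ∑ i : ZMod N, (ZMod.stdAddChar (i * (q - p)) : ℂ) :=
        Finset.sum_congr rfl fun i _ => by
          rw [← AddChar.map_add_eq_mul]; congr 1; ring
    _ = _ := by
        rw [h]
        by_cases hpq : p = q
        · simp [hpq]
        · simp [hpq, sub_eq_zero, Ne.symm hpq]

lemma dft2_idft2 (x : ZMod a × ZMod b → ℂ) (pq : ZMod a × ZMod b) :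
    dft2 a b (idft2 a b x) pq = x pq := by
  have hs : (1 / (Real.sqrt ((a : ℝ) * b) : ℂ)) * (1 / (Real.sqrt ((a : ℝ) * b) : ℂ)) *
      ((a : ℂ) * b) = 1 := by
    have h : (Real.sqrt ((a : ℝ) * b) : ℂ) * (Real.sqrt ((a : ℝ) * b) : ℂ) = (a : ℂ) * b := by
      rw [← Complex.ofReal_mul, Real.mul_self_sqrt (by positivity)]
      push_cast; rfl
    have ha : (a : ℂ) ≠ 0 := NeZero.ne _
    have hb : (b : ℂ) ≠ 0 := NeZero.ne _
    rw [div_mul_div_comm, h]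
    field_simp
  simp only [dft2_apply, idft2_apply]
  calc _ = (1 / (Real.sqrt ((a : ℝ) * b) : ℂ)) * (1 / (Real.sqrt ((a : ℝ) * b) : ℂ)) *
      ∑ kl : ZMod a × ZMod b,
        (∑ i : ZMod a, (ZMod.stdAddChar (-(pq.1 * i)) * ZMod.stdAddChar (i * kl.1) : ℂ)) *
        (∑ j : ZMod b, (ZMod.stdAddChar (-(pq.2 * j)) * ZMod.stdAddChar (j * kl.2) : ℂ)) *
        x kl := by
        conv_lhs => simp only [Finset.mul_sum]
        rw [Finset.sum_comm, Finset.mul_sum]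
        refine Finset.sum_congr rfl fun kl _ => ?_
        rw [Finset.sum_mul_sum, Finset.sum_mul, Finset.mul_sum, Fintype.sum_prod_type]
        refine Finset.sum_congr rfl fun i _ => ?_
        rw [Finset.sum_mul, Finset.mul_sum]
        exact Finset.sum_congr rfl fun j _ => by ring
    _ = _ := by
        simp only [ZMod.sum_stdAddChar_neg_mul_mul]
        rw [Finset.sum_eq_single pq]
        · simp only [if_true]
          rw [← mul_assoc, hs, one_mul]
        · intro kl _ hkl
          by_cases h1 : pq.1 = kl.1
          · have h2 : pq.2 ≠ kl.2 := fun h2 => hkl (Prod.ext h1 h2).symm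
            simp [h2]
          · simp [h1]
        · simp

lemma sum_conj_idft2_mul (w z : ZMod a × ZMod b → ℂ) :
    ∑ pq, (starRingEnd ℂ) (idft2 a b w pq) * z pq =
      ∑ pq, (starRingEnd ℂ) (w pq) * dft2 a b z pq := by
  simp only [dft2_apply, idft2_apply, map_mul, map_sum, map_div₀, map_one, Complex.conj_ofReal,
    ZMod.conj_stdAddChar, Finset.mul_sum, Finset.sum_mul]
  rw [Finset.sum_comm]
  refine Finset.sum_congr rfl fun p _ => Finset.sum_congr rfl fun i _ => ?_
  rw [mul_comm i.1, mul_comm i.2]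
  ring

end DFT

section Decimation

variable {n d : ℕ} [NeZero n] [NeZero d]

lemma ZMod.val_natCast_mul_val (i : ZMod n) :
    (((d * i.val : ℕ) : ZMod (n * d))).val = d * i.val := by
  apply ZMod.val_cast_of_lt
  rw [mul_comm n d]
  exact Nat.mul_lt_mul_of_pos_left (ZMod.val_lt i) (NeZero.pos d)

lemma ZMod.natCast_val_mul_div (i : ZMod n) :
    (((((d * i.val : ℕ) : ZMod (n * d))).val / d : ℕ) : ZMod n) = i := by
  rw [ZMod.val_natCast_mul_val, Nat.mul_div_cancel_left _ (NeZero.pos d)]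
  simp

lemma ZMod.natCast_mul_val_div (p : ZMod (n * d)) (h : d ∣ p.val) :
    ((d * ((p.val / d : ℕ) : ZMod n).val : ℕ) : ZMod (n * d)) = p := by
  rw [ZMod.val_cast_of_lt, Nat.mul_div_cancel' h]
  · simp
  · exact Nat.div_lt_of_lt_mul (by rw [mul_comm d n]; exact ZMod.val_lt p)

lemma ZMod.sum_filter_val_mod {M : Type*} [AddCommMonoid M] (c : ZMod n)
    (g : ZMod (n * d) → M) :
    ∑ p : ZMod (n * d) with p.val % n = c.val, g p =
      ∑ k ∈ Finset.range d, g ((c.val + n * k : ℕ) : ZMod (n * d)) := by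
  symm
  have hv : ∀ k < d, (((c.val + n * k : ℕ) : ZMod (n * d))).val = c.val + n * k := by
    intro k hk
    apply ZMod.val_cast_of_lt
    have := ZMod.val_lt c
    calc c.val + n * k < n * (k + 1) := by rw [mul_add]; omega
      _ ≤ n * d := Nat.mul_le_mul_left _ hk
  refine Finset.sum_nbij' (fun k => ((c.val + n * k : ℕ) : ZMod (n * d)))
    (fun p => p.val / n) ?_ ?_ ?_ ?_ ?_
  · intro k hk
    rw [Finset.mem_filter, hv k (Finset.mem_range.1 hk)]
    refine ⟨Finset.mem_univ _, ?_⟩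
    rw [Nat.add_mul_mod_self_left, Nat.mod_eq_of_lt (ZMod.val_lt c)]
  · intro p _
    exact Finset.mem_range.2 (Nat.div_lt_of_lt_mul (ZMod.val_lt p))
  · intro k hk
    rw [hv k (Finset.mem_range.1 hk), Nat.add_mul_div_left _ _ (NeZero.pos n),
      Nat.div_eq_of_lt (ZMod.val_lt c), zero_add]
  · intro p hp
    rw [← (Finset.mem_filter.1 hp).2, Nat.mod_add_div]
    simp
  · intro k _
    rfl

lemma ZMod.sum_filter_stdAddChar (p i : ZMod (n * d)) (c : ZMod n) (hp : p.val % n = c.val) :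
    ∑ p' : ZMod (n * d) with p'.val % n = c.val, (ZMod.stdAddChar (-(p' * i)) : ℂ) =
      if d ∣ i.val then (d : ℂ) * ZMod.stdAddChar (-(p * i)) else 0 := by
  have hterm : ∀ k : ℕ, (ZMod.stdAddChar (-(((c.val + n * k : ℕ) : ZMod (n * d)) * i)) : ℂ) =
      ZMod.stdAddChar (-((c.val : ZMod (n * d)) * i)) *
        ZMod.stdAddChar (-((n : ZMod (n * d)) * i)) ^ k := by
    intro k
    rw [← AddChar.map_nsmul_eq_pow, ← AddChar.map_add_eq_mul]
    congr 1
    push_cast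
    rw [nsmul_eq_mul]
    ring
  have hnd : (n : ZMod (n * d)) * (d : ZMod (n * d)) = 0 := by
    rw [← Nat.cast_mul, ZMod.natCast_self]
  rw [ZMod.sum_filter_val_mod]
  simp only [hterm, ← Finset.mul_sum]
  split_ifs with h
  · obtain ⟨m, hm⟩ := h
    have hi : i = (d : ZMod (n * d)) * m := by
      rw [← Nat.cast_mul, ← hm]; simp
    have hni : (n : ZMod (n * d)) * i = 0 := by
      rw [hi, ← mul_assoc, hnd, zero_mul]
    have hpi : p * i = (c.val : ZMod (n * d)) * i := by
      have : p = ((c.val + n * (p.val / n) : ℕ) : ZMod (n * d)) := by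
        rw [← hp, Nat.mod_add_div]; simp
      rw [this]
      push_cast
      linear_combination ((p.val / n : ℕ) : ZMod (n * d)) * hni
    rw [hni, hpi]
    simp [mul_comm]
  · set w : ℂ := ZMod.stdAddChar (-((n : ZMod (n * d)) * i)) with hw
    have hw1 : w ≠ 1 := by
      intro hw'
      apply h
      have h0 : (ZMod.stdAddChar (-((n : ZMod (n * d)) * i)) : ℂ) =
          ZMod.stdAddChar (0 : ZMod (n * d)) := by
        rw [← hw, hw', AddChar.map_zero_eq_one]
      have h1 := neg_eq_zero.1 (ZMod.injective_stdAddChar h0)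
      have h2 : ((n * i.val : ℕ) : ZMod (n * d)) = 0 := by
        push_cast; simpa using h1
      rw [ZMod.natCast_eq_zero_iff] at h2
      exact Nat.dvd_of_mul_dvd_mul_left (NeZero.pos n) h2
    have hwd : w ^ d = 1 := by
      rw [hw, ← AddChar.map_nsmul_eq_pow, nsmul_eq_mul]
      have : (d : ZMod (n * d)) * -((n : ZMod (n * d)) * i) = 0 := by
        linear_combination -i * hnd
      rw [this, AddChar.map_zero_eq_one]
    rw [geom_sum_eq hw1, hwd]
    simp

end Decimation

section ZeroFill

variable {n_r n_c d_r d_c : ℕ} [NeZero n_r] [NeZero n_c] [NeZero d_r] [NeZero d_c]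

lemma decim_zfill (y : ZMod n_r × ZMod n_c → ℂ) (ij : ZMod n_r × ZMod n_c) :
    decim n_r n_c d_r d_c (zfill n_r n_c d_r d_c y) ij = y ij := by
  simp only [decim, zfill]
  rw [ZMod.natCast_val_mul_div, ZMod.natCast_val_mul_div, if_pos]
  simp only [ZMod.val_natCast_mul_val, dvd_mul_right, and_self]

lemma zfill_decim (z : ZMod (n_r * d_r) × ZMod (n_c * d_c) → ℂ)
    (pq : ZMod (n_r * d_r) × ZMod (n_c * d_c)) :
    zfill n_r n_c d_r d_c (decim n_r n_c d_r d_c z) pq =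
      if d_r ∣ pq.1.val ∧ d_c ∣ pq.2.val then z pq else 0 := by
  simp only [decim, zfill]
  refine if_ctx_congr Iff.rfl (fun h => ?_) (fun _ => rfl)
  rw [ZMod.natCast_mul_val_div _ h.1, ZMod.natCast_mul_val_div _ h.2]

lemma sum_conj_decim_mul (w : ZMod (n_r * d_r) × ZMod (n_c * d_c) → ℂ)
    (y : ZMod n_r × ZMod n_c → ℂ) :
    ∑ ij, (starRingEnd ℂ) (decim n_r n_c d_r d_c w ij) * y ij =
      ∑ pq, (starRingEnd ℂ) (w pq) * zfill n_r n_c d_r d_c y pq := by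
  simp only [zfill, mul_ite, mul_zero]
  rw [← Finset.sum_filter]
  refine Finset.sum_nbij'
    (fun ij => (((d_r * ij.1.val : ℕ) : ZMod (n_r * d_r)),
      ((d_c * ij.2.val : ℕ) : ZMod (n_c * d_c))))
    (fun pq => (((pq.1.val / d_r : ℕ) : ZMod n_r), ((pq.2.val / d_c : ℕ) : ZMod n_c)))
    ?_ ?_ ?_ ?_ ?_
  · intro ij _
    rw [Finset.mem_filter]
    simp only [ZMod.val_natCast_mul_val, dvd_mul_right, and_self, Finset.mem_univ]
  · intro pq _
    exact Finset.mem_univ _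
  · intro ij _
    simp only [ZMod.natCast_val_mul_div]
  · intro pq hpq
    obtain ⟨-, h1, h2⟩ := Finset.mem_filter.1 hpq
    simp only [ZMod.natCast_mul_val_div _ h1, ZMod.natCast_mul_val_div _ h2]
  · intro ij _
    simp only [ZMod.natCast_val_mul_div, decim]

/-- Decimation followed by zero-filling averages the spectrum over aliasing classes. -/
lemma dft2_zfill_decim (z : ZMod (n_r * d_r) × ZMod (n_c * d_c) → ℂ)
    (c : ZMod n_r × ZMod n_c) (pq : ZMod (n_r * d_r) × ZMod (n_c * d_c))
    (hpq : pq.1.val % n_r = c.1.val ∧ pq.2.val % n_c = c.2.val) :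
    (d_r * d_c : ℂ) *
        dft2 (n_r * d_r) (n_c * d_c) (zfill n_r n_c d_r d_c (decim n_r n_c d_r d_c z)) pq =
      ∑ p : ZMod (n_r * d_r) × ZMod (n_c * d_c) with
        p.1.val % n_r = c.1.val ∧ p.2.val % n_c = c.2.val,
        dft2 (n_r * d_r) (n_c * d_c) z p := by
  have hcls : (Finset.univ.filter fun p : ZMod (n_r * d_r) × ZMod (n_c * d_c) =>
      p.1.val % n_r = c.1.val ∧ p.2.val % n_c = c.2.val) =
      (Finset.univ.filter fun p : ZMod (n_r * d_r) => p.val % n_r = c.1.val) ×ˢ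
      (Finset.univ.filter fun p : ZMod (n_c * d_c) => p.val % n_c = c.2.val) := by
    ext; simp
  simp only [dft2_apply, zfill_decim]
  rw [← Finset.mul_sum, Finset.sum_comm, mul_left_comm]
  congr 1
  rw [Finset.mul_sum]
  refine Finset.sum_congr rfl fun i _ => ?_
  rw [← Finset.sum_mul, hcls, Finset.sum_product]
  dsimp only
  rw [← Finset.sum_mul_sum,
    ZMod.sum_filter_stdAddChar _ _ _ hpq.1, ZMod.sum_filter_stdAddChar _ _ _ hpq.2]
  by_cases h1 : d_r ∣ i.1.val <;> by_cases h2 : d_c ∣ i.2.val <;> simp [h1, h2]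
  ring

end ZeroFill

lemma Complex.sum_normSq_add_mul_sub {ι : Type*} [Fintype ι] (A B y : ι → ℂ) (t : ℝ) :
    ∑ i, Complex.normSq (A i + t * B i - y i) =
      ∑ i, Complex.normSq (A i - y i) +
        t * (2 * (∑ i, (starRingEnd ℂ) (B i) * (A i - y i)).re) +
        t ^ 2 * ∑ i, Complex.normSq (B i) := by
  simp only [Complex.re_sum, Finset.mul_sum, ← Finset.sum_add_distrib]
  refine Finset.sum_congr rfl fun i _ => ?_
  simp [Complex.normSq_apply]
  ring

lemma eq_zero_of_forall_mul_add_sq_mul_nonneg {B C : ℝ}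
    (h : ∀ t : ℝ, 0 ≤ t * B + t ^ 2 * C) : B = 0 := by
  have hd : discrim C B 0 ≤ 0 := discrim_le_zero fun t => by nlinarith [h t]
  have : B ^ 2 ≤ 0 := by simpa [discrim] using hd
  nlinarith [sq_nonneg B]

section Optimality

variable {n_r n_c d_r d_c s : ℕ} [NeZero n_r] [NeZero n_c] [NeZero d_r] [NeZero d_c]

/-- The normal equations of the regularized least-squares problem, in the Fourier domain. -/
lemma dft2_normal_equation
    (lam : ZMod (n_r * d_r) × ZMod (n_c * d_c) → ℂ)
    (gam : Fin s → ZMod (n_r * d_r) × ZMod (n_c * d_c) → ℂ) (eps μ : ℝ)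
    (b : ZMod n_r × ZMod n_c → ℂ)
    (v : Fin s → ZMod (n_r * d_r) × ZMod (n_c * d_c) → ℂ)
    (F : (ZMod (n_r * d_r) × ZMod (n_c * d_c) → ℂ) →
      ZMod (n_r * d_r) × ZMod (n_c * d_c) → ℂ)
    (hF : F = dft2 (n_r * d_r) (n_c * d_c))
    (M : (ZMod (n_r * d_r) × ZMod (n_c * d_c) → ℂ) →
      (ZMod (n_r * d_r) × ZMod (n_c * d_c) → ℂ) → ZMod (n_r * d_r) × ZMod (n_c * d_c) → ℂ)
    (hM : M = fun h x => idft2 (n_r * d_r) (n_c * d_c) (fun pq => h pq * F x pq))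
    (f : (ZMod (n_r * d_r) × ZMod (n_c * d_c) → ℂ) → ℝ)
    (hf : ∀ x, f x =
      μ / 2 * (∑ ij, Complex.normSq (decim n_r n_c d_r d_c (M lam x) ij - b ij))
      + 1 / 2 * (∑ j, ∑ pq, Complex.normSq (M (gam j) x pq - v j pq))
      + eps / 2 * (∑ pq, Complex.normSq (x pq)))
    (x : ZMod (n_r * d_r) × ZMod (n_c * d_c) → ℂ) (hx : ∀ y, f x ≤ f y)
    (pq : ZMod (n_r * d_r) × ZMod (n_c * d_c)) :
    μ * ((starRingEnd ℂ) (lam pq) *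
        F (zfill n_r n_c d_r d_c fun ij => decim n_r n_c d_r d_c (M lam x) ij - b ij) pq)
      + ∑ j, (starRingEnd ℂ) (gam j pq) * (gam j pq * F x pq - F (v j) pq)
      + eps * F x pq = 0 := by
  set g : ZMod (n_r * d_r) × ZMod (n_c * d_c) → ℂ := fun pq =>
    μ * ((starRingEnd ℂ) (lam pq) *
        F (zfill n_r n_c d_r d_c fun ij => decim n_r n_c d_r d_c (M lam x) ij - b ij) pq)
      + ∑ j, (starRingEnd ℂ) (gam j pq) * (gam j pq * F x pq - F (v j) pq)
      + eps * F x pq with hg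
  have hFM : ∀ h pq, F (M h x) pq = h pq * F x pq := fun h pq => by
    rw [hM, hF]; exact dft2_idft2 _ _
  -- `u` is the spectrum of the direction of perturbation
  have hMt : ∀ (h u : ZMod (n_r * d_r) × ZMod (n_c * d_c) → ℂ) (t : ℝ) pq,
      M h (fun i => x i + t * idft2 (n_r * d_r) (n_c * d_c) u i) pq =
        M h x pq + t * idft2 (n_r * d_r) (n_c * d_c) (fun i => h i * u i) pq := by
    intro h u t pq
    simp only [hM, hF, dft2_add_mul, dft2_idft2, ← idft2_add_mul]
    congr 1
    ext i
    ring
  have hadj : ∀ (h u z : ZMod (n_r * d_r) × ZMod (n_c * d_c) → ℂ),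
      ∑ pq, (starRingEnd ℂ) (idft2 (n_r * d_r) (n_c * d_c) (fun i => h i * u i) pq) * z pq =
        ∑ pq, (starRingEnd ℂ) (u pq) * ((starRingEnd ℂ) (h pq) * F z pq) := by
    intro h u z
    rw [sum_conj_idft2_mul, hF]
    exact Finset.sum_congr rfl fun _ _ => by rw [map_mul]; ring
  have hstat : ∀ u : ZMod (n_r * d_r) × ZMod (n_c * d_c) → ℂ,
      (∑ pq, (starRingEnd ℂ) (u pq) * g pq).re = 0 := by
    intro u
    have hlin : (∑ pq, (starRingEnd ℂ) (u pq) * g pq).re =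
        μ * (∑ ij, (starRingEnd ℂ) (decim n_r n_c d_r d_c
          (idft2 (n_r * d_r) (n_c * d_c) (fun i => lam i * u i)) ij) *
            (decim n_r n_c d_r d_c (M lam x) ij - b ij)).re
        + (∑ j, (∑ pq, (starRingEnd ℂ)
          (idft2 (n_r * d_r) (n_c * d_c) (fun i => gam j i * u i) pq) *
            (M (gam j) x pq - v j pq)).re)
        + eps * (∑ pq, (starRingEnd ℂ) (idft2 (n_r * d_r) (n_c * d_c) u pq) * (x pq - 0)).re := by
      have hFs : ∀ j pq, F (fun i => M (gam j) x i - v j i) pq =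
          gam j pq * F x pq - F (v j) pq := fun j pq => by
        rw [← hFM, hF, dft2_sub]
      rw [sum_conj_decim_mul, hadj]
      simp only [fun j => hadj (gam j) u fun i => M (gam j) x i - v j i, hFs, sub_zero]
      rw [sum_conj_idft2_mul, ← hF, ← Complex.re_sum, ← Complex.re_ofReal_mul,
        ← Complex.re_ofReal_mul, ← Complex.add_re, ← Complex.add_re]
      congr 1
      rw [Finset.sum_comm, Finset.mul_sum, Finset.mul_sum, ← Finset.sum_add_distrib,
        ← Finset.sum_add_distrib]
      refine Finset.sum_congr rfl fun i _ => ?_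
      rw [← Finset.mul_sum, hg]
      ring
    rw [hlin]
    refine eq_zero_of_forall_mul_add_sq_mul_nonneg (C :=
      μ / 2 * (∑ ij, Complex.normSq (decim n_r n_c d_r d_c
          (idft2 (n_r * d_r) (n_c * d_c) (fun i => lam i * u i)) ij))
      + 1 / 2 * (∑ j, ∑ pq, Complex.normSq
          (idft2 (n_r * d_r) (n_c * d_c) (fun i => gam j i * u i) pq))
      + eps / 2 * (∑ pq, Complex.normSq (idft2 (n_r * d_r) (n_c * d_c) u pq))) fun t => ?_
    have h := hx (fun i => x i + t * idft2 (n_r * d_r) (n_c * d_c) u i)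
    rw [hf, hf] at h
    have h1 := Complex.sum_normSq_add_mul_sub (decim n_r n_c d_r d_c (M lam x))
      (decim n_r n_c d_r d_c (idft2 (n_r * d_r) (n_c * d_c) (fun i => lam i * u i))) b t
    have h2 := fun j => Complex.sum_normSq_add_mul_sub (M (gam j) x)
      (idft2 (n_r * d_r) (n_c * d_c) (fun i => gam j i * u i)) (v j) t
    have h3 := Complex.sum_normSq_add_mul_sub x (idft2 (n_r * d_r) (n_c * d_c) u) (fun _ => 0) t
    simp only [hMt, h2, Finset.sum_add_distrib, ← Finset.mul_sum] at h
    simp only [decim, hMt] at h h1 ⊢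
    simp only [sub_zero] at h3 ⊢
    rw [h1, h3] at h
    linarith
  have h := hstat g
  rw [Complex.re_sum] at h
  have hn : ∀ i, ((starRingEnd ℂ) (g i) * g i).re = Complex.normSq (g i) := fun i => by
    rw [← Complex.normSq_eq_conj_mul_self, Complex.ofReal_re]
  simp only [hn] at h
  exact Complex.normSq_eq_zero.1
    ((Finset.sum_eq_zero_iff_of_nonneg fun i _ => Complex.normSq_nonneg _).1 h pq
      (Finset.mem_univ _))

end Optimality

/-- Residue-class sums of the Fourier transform of the high-resolution
residual `r_H(μ) = K x*(μ) − S^H b` have the closed form `(ν_c − ρ_c)/(1 + η_c·μ)`. -/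
theorem classSum_dft_residual_closed_form
    (n_r n_c d_r d_c s : ℕ) [NeZero n_r] [NeZero n_c] [NeZero d_r] [NeZero d_c]
    (lam : ZMod (n_r * d_r) × ZMod (n_c * d_c) → ℂ)
    (gam : Fin s → ZMod (n_r * d_r) × ZMod (n_c * d_c) → ℂ)
    (eps μ : ℝ) (heps : 0 < eps) (hμ : 0 < μ)
    (b : ZMod n_r × ZMod n_c → ℂ)
    (v : Fin s → ZMod (n_r * d_r) × ZMod (n_c * d_c) → ℂ)
    (F : (ZMod (n_r * d_r) × ZMod (n_c * d_c) → ℂ) → ZMod (n_r * d_r) × ZMod (n_c * d_c) → ℂ)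
    (hF : F = dft2 (n_r * d_r) (n_c * d_c))
    (K : (ZMod (n_r * d_r) × ZMod (n_c * d_c) → ℂ) → ZMod (n_r * d_r) × ZMod (n_c * d_c) → ℂ)
    (hK : K = fun x => idft2 (n_r * d_r) (n_c * d_c) (fun pq => lam pq * F x pq))
    (Lop : Fin s → (ZMod (n_r * d_r) × ZMod (n_c * d_c) → ℂ) → ZMod (n_r * d_r) × ZMod (n_c * d_c) → ℂ)
    (hL : Lop = fun j x => idft2 (n_r * d_r) (n_c * d_c) (fun pq => gam j pq * F x pq))
    (f : (ZMod (n_r * d_r) × ZMod (n_c * d_c) → ℂ) → ℝ)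
    (hf : f = fun x =>
      μ / 2 * (∑ ij : ZMod n_r × ZMod n_c,
          Complex.normSq (decim n_r n_c d_r d_c (K x) ij - b ij))
      + 1 / 2 * (∑ j : Fin s, ∑ pq : ZMod (n_r * d_r) × ZMod (n_c * d_c),
          Complex.normSq (Lop j x pq - v j pq))
      + eps / 2 * (∑ pq : ZMod (n_r * d_r) × ZMod (n_c * d_c), Complex.normSq (x pq)))
    -- x*(μ) is the (unique) global minimizer of f
    (xstar : ZMod (n_r * d_r) × ZMod (n_c * d_c) → ℂ)
    (hxstar : ∀ x, f xstar ≤ f x) :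
    let zeta : ZMod (n_r * d_r) × ZMod (n_c * d_c) → ℝ := fun pq =>
      ∑ j : Fin s, Complex.normSq (gam j pq)
    let cls : ZMod n_r × ZMod n_c → Finset (ZMod (n_r * d_r) × ZMod (n_c * d_c)) := fun c =>
      Finset.univ.filter (fun pq => pq.1.val % n_r = c.1.val ∧ pq.2.val % n_c = c.2.val)
    let eta : ZMod n_r × ZMod n_c → ℝ := fun c =>
      (1 / ((d_r : ℝ) * d_c)) * ∑ pq ∈ cls c, Complex.normSq (lam pq) / (zeta pq + eps)
    let rho : ZMod n_r × ZMod n_c → ℂ := fun c =>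
      ∑ pq ∈ cls c, F (zfill n_r n_c d_r d_c b) pq
    let nu : ZMod n_r × ZMod n_c → ℂ := fun c =>
      ∑ pq ∈ cls c,
        lam pq * (∑ j : Fin s, (starRingEnd ℂ) (gam j pq) * F (v j) pq) /
          (((zeta pq + eps : ℝ) : ℂ))
    let r_H : ZMod (n_r * d_r) × ZMod (n_c * d_c) → ℂ := fun pq =>
      K xstar pq - zfill n_r n_c d_r d_c b pq
    ∀ c : ZMod n_r × ZMod n_c,
      (∑ pq ∈ cls c, F r_H pq)
        = (nu c - rho c) / (1 + ((eta c : ℝ) : ℂ) * (μ : ℂ)) := by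
  intro zeta cls eta rho nu r_H c
  have hzeta : ∀ pq, 0 ≤ zeta pq := fun pq => Finset.sum_nonneg fun j _ => Complex.normSq_nonneg _
  have hz : ∀ pq, ((zeta pq + eps : ℝ) : ℂ) ≠ 0 := fun pq =>
    Complex.ofReal_ne_zero.2 (by linarith [hzeta pq])
  have heta : 0 ≤ eta c := by
    refine mul_nonneg (by positivity) (Finset.sum_nonneg fun pq _ => div_nonneg
      (Complex.normSq_nonneg _) (by linarith [hzeta pq]))
  have hden : (1 + ((eta c : ℝ) : ℂ) * (μ : ℂ)) ≠ 0 := by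
    have : (0 : ℝ) < 1 + eta c * μ := by positivity
    exact_mod_cast this.ne'
  have hFr : ∀ pq, F r_H pq = lam pq * F xstar pq - F (zfill n_r n_c d_r d_c b) pq := by
    intro pq
    have h := dft2_idft2 (a := n_r * d_r) (b := n_c * d_c) (fun pq => lam pq * F xstar pq) pq
    rw [← h]
    simp only [r_H, hK, hF]
    rw [dft2_sub]
  have hnormal := dft2_normal_equation lam gam eps μ b v F hF
    (fun h x => idft2 (n_r * d_r) (n_c * d_c) (fun pq => h pq * F x pq)) rfl f
    (fun x => by rw [hf, hK, hL]) xstar hxstar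
  have hdec : (fun ij => decim n_r n_c d_r d_c
      (idft2 (n_r * d_r) (n_c * d_c) (fun pq => lam pq * F xstar pq)) ij - b ij) =
      decim n_r n_c d_r d_c r_H := by
    ext ij
    have h := decim_zfill (d_r := d_r) (d_c := d_c) b ij
    simp only [decim] at h
    simp only [decim, r_H, hK, h]
  have hd : ((d_r : ℂ) * d_c) ≠ 0 := mul_ne_zero (NeZero.ne _) (NeZero.ne _)
  set R := ∑ pq ∈ cls c, F r_H pq with hR
  have hpoint : ∀ pq ∈ cls c, F r_H pq =
      lam pq * (∑ j : Fin s, (starRingEnd ℂ) (gam j pq) * F (v j) pq) /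
          (((zeta pq + eps : ℝ) : ℂ)) - F (zfill n_r n_c d_r d_c b) pq
        - μ * (1 / (d_r * d_c) * R) *
          ((Complex.normSq (lam pq) / (zeta pq + eps) : ℝ) : ℂ) := by
    intro pq hpq
    have halias := dft2_zfill_decim r_H c pq (Finset.mem_filter.1 hpq).2
    rw [← hF] at halias
    have hW : F (zfill n_r n_c d_r d_c (decim n_r n_c d_r d_c r_H)) pq =
        1 / (d_r * d_c) * R := by
      rw [hR, one_div, eq_inv_mul_iff_mul_eq₀ hd]
      exact halias
    have h := hnormal pq
    rw [hdec, hW] at h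
    have hsum : ∑ j, (starRingEnd ℂ) (gam j pq) * (gam j pq * F xstar pq - F (v j) pq) =
        (zeta pq : ℂ) * F xstar pq - ∑ j, (starRingEnd ℂ) (gam j pq) * F (v j) pq := by
      simp only [zeta, Complex.ofReal_sum, Finset.sum_mul, ← Finset.sum_sub_distrib,
        Complex.normSq_eq_conj_mul_self]
      exact Finset.sum_congr rfl fun _ _ => by ring
    rw [hsum] at h
    have hz' := hz pq
    rw [hFr, Complex.ofReal_div, Complex.normSq_eq_conj_mul_self]
    generalize ∑ j, (starRingEnd ℂ) (gam j pq) * F (v j) pq = T at h ⊢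
    generalize 1 / ((d_r : ℂ) * d_c) * R = Q at h ⊢
    have hX : lam pq * F xstar pq =
        (lam pq * T - μ * Q * ((starRingEnd ℂ) (lam pq) * lam pq)) /
          ((zeta pq + eps : ℝ) : ℂ) := by
      rw [eq_div_iff hz']
      push_cast
      linear_combination lam pq * h
    rw [hX]
    ring
  have hkey : R = nu c - rho c - eta c * μ * R := by
    conv_lhs => rw [hR, Finset.sum_congr rfl hpoint]
    rw [Finset.sum_sub_distrib, Finset.sum_sub_distrib, ← Finset.mul_sum]
    simp only [nu, rho, eta]
    push_cast
    ring
  rw [eq_div_iff hden]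
  linear_combination hkey
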